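/- arXiv:1706.09151 — 4 statements merged into one kernel-verified Lean document; each statement's English description precedes it below -/
import Mathlib

section
/- Let χ : [0,1] → ℝ² be continuous, let R ∈ ℝ^{2×2} be symmetric positive definite, and let N ∈ ℕ. Define 𝔛_k = ∫₀¹ χ(x) ℒ_k(x) dx ∈ ℝ² for 0 ≤ k ≤ N. Then ∫₀¹ χ(x)ᵀ R χ(x) dx ≥ Σ_{k=0}^{N} (2k+1) 𝔛_kᵀ R 𝔛_k. -/
open Set Matrix

/-- The shifted Legendre polynomial on `[0,1]`:
`ℒ_k(x) = (−1)^k Σ_{l=0}^{k} (−1)^l (k choose l) ((k+l) choose l) x^l`. -/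
noncomputable def shiftedLegendre (k : ℕ) (x : ℝ) : ℝ :=
  (-1 : ℝ)^k * ∑ l ∈ Finset.range (k+1),
    (-1 : ℝ)^l * (k.choose l : ℝ) * ((k+l).choose l : ℝ) * x^l

open scoped Polynomial Nat

lemma shiftedLegendre_eq_aeval (k : ℕ) (x : ℝ) :
    shiftedLegendre k x = (-1) ^ k * Polynomial.aeval x (Polynomial.shiftedLegendre k) := by
  simp only [shiftedLegendre, Polynomial.shiftedLegendre, map_sum, map_mul, map_pow,
    Polynomial.aeval_X, Polynomial.aeval_C]
  congr 1
  refine Finset.sum_congr rfl fun l _ => ?_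
  simp [(Nat.choose_symm_add : (k + l).choose k = (k + l).choose l)]

/-- The shifted Legendre polynomial, as a polynomial with real coefficients. -/
noncomputable def realShiftedLegendre (k : ℕ) : ℝ[X] :=
  (-1) ^ k * (Polynomial.shiftedLegendre k).map (Int.castRingHom ℝ)

lemma eval_realShiftedLegendre (k : ℕ) (x : ℝ) :
    (realShiftedLegendre k).eval x = shiftedLegendre k x := by
  rw [shiftedLegendre_eq_aeval, realShiftedLegendre, Polynomial.aeval_def, Polynomial.eval_mul,
    Polynomial.eval_map]
  simp

lemma natDegree_realShiftedLegendre (k : ℕ) : (realShiftedLegendre k).natDegree = k := by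
  rcases neg_one_pow_eq_or ℝ[X] k with h | h <;>
    simp [realShiftedLegendre, h,
      Polynomial.natDegree_map_eq_of_injective (RingHom.injective_int (Int.castRingHom ℝ))]

lemma factorial_mul_realShiftedLegendre (k : ℕ) :
    (k ! : ℝ[X]) * realShiftedLegendre k =
      (-1) ^ k * Polynomial.derivative^[k] (Polynomial.X ^ k * (1 - Polynomial.X) ^ k) := by
  have h := congrArg (Polynomial.map (Int.castRingHom ℝ))
    (Polynomial.factorial_mul_shiftedLegendre_eq k)
  simp only [← Polynomial.iterate_derivative_map, Polynomial.map_mul, Polynomial.map_natCast,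
    Polynomial.map_pow, Polynomial.map_X,
    Polynomial.map_sub, Polynomial.map_one] at h
  rw [← h, realShiftedLegendre]
  ring

lemma Polynomial.eval_iterate_derivative_X_pow_mul_one_sub_X_pow {n j : ℕ} (hj : j < n) :
    (derivative^[j] (X ^ n * (1 - X) ^ n : ℝ[X])).eval 0 = 0 ∧
      (derivative^[j] (X ^ n * (1 - X) ^ n : ℝ[X])).eval 1 = 0 := by
  have hne : n - j ≠ 0 := by omega
  constructor
  · obtain ⟨q, hq⟩ := pow_sub_dvd_iterate_derivative_of_pow_dvd j
      (Dvd.intro ((1 - X) ^ n) rfl : (X : ℝ[X]) ^ n ∣ X ^ n * (1 - X) ^ n)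
    simp [hq, hne]
  · obtain ⟨q, hq⟩ := pow_sub_dvd_iterate_derivative_of_pow_dvd j
      (Dvd.intro_left (X ^ n) rfl : (1 - X : ℝ[X]) ^ n ∣ X ^ n * (1 - X) ^ n)
    simp [hq, hne]

lemma Polynomial.integral_eval_mul_eval_derivative (p q : ℝ[X]) (a b : ℝ) :
    ∫ x in a..b, p.eval x * (derivative q).eval x =
      p.eval b * q.eval b - p.eval a * q.eval a - ∫ x in a..b, (derivative p).eval x * q.eval x :=
  intervalIntegral.integral_mul_deriv_eq_deriv_mul (fun x _ => p.hasDerivAt x)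
    (fun x _ => q.hasDerivAt x) ((derivative p).continuous.intervalIntegrable _ _)
    ((derivative q).continuous.intervalIntegrable _ _)

lemma Polynomial.integral_eval_mul_iterate_derivative_eq_zero {n j : ℕ} (hj : j ≤ n) (p : ℝ[X])
    (hp : p.degree < j) :
    ∫ x in (0 : ℝ)..1, p.eval x * (derivative^[j] (X ^ n * (1 - X) ^ n : ℝ[X])).eval x = 0 := by
  induction j generalizing p with
  | zero =>
    have : p = 0 := by simpa [Nat.WithBot.lt_zero_iff] using hp
    simp [this]
  | succ j ih =>
    obtain ⟨h0, h1⟩ := eval_iterate_derivative_X_pow_mul_one_sub_X_pow (Nat.lt_of_succ_le hj)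
    rw [Function.iterate_succ_apply', integral_eval_mul_eval_derivative, h0, h1,
      ih (by omega) (derivative p)]
    · simp
    · by_cases h : p = 0
      · simp [h]
      · refine (degree_derivative_lt h).trans_le ?_
        rw [degree_eq_natDegree h] at hp ⊢
        norm_cast at hp ⊢
        omega

lemma integral_eval_mul_shiftedLegendre_eq_zero {k : ℕ} (p : ℝ[X]) (hp : p.degree < k) :
    ∫ x in (0 : ℝ)..1, p.eval x * shiftedLegendre k x = 0 := by
  have hk : (k ! : ℝ) ≠ 0 := by positivity
  have h : ∀ x, k ! * (p.eval x * shiftedLegendre k x) = (-1) ^ k * (p.eval x *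
      (Polynomial.derivative^[k] (Polynomial.X ^ k * (1 - Polynomial.X) ^ k : ℝ[X])).eval x) := by
    intro x
    have h := congrArg (Polynomial.eval x) (factorial_mul_realShiftedLegendre k)
    simp only [Polynomial.eval_mul, Polynomial.eval_natCast, eval_realShiftedLegendre,
      Polynomial.eval_pow, Polynomial.eval_neg, Polynomial.eval_one] at h
    linear_combination p.eval x * h
  refine (mul_eq_zero.mp ?_).resolve_left hk
  rw [← intervalIntegral.integral_const_mul]
  simp only [h]
  rw [intervalIntegral.integral_const_mul,
    Polynomial.integral_eval_mul_iterate_derivative_eq_zero le_rfl p hp, mul_zero]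

lemma integral_shiftedLegendre_mul_of_ne {j k : ℕ} (h : j ≠ k) :
    ∫ x in (0 : ℝ)..1, shiftedLegendre j x * shiftedLegendre k x = 0 := by
  wlog hjk : j < k generalizing j k
  · simpa only [mul_comm] using this h.symm (by omega)
  simpa only [eval_realShiftedLegendre] using
    integral_eval_mul_shiftedLegendre_eq_zero (realShiftedLegendre j)
      (Polynomial.degree_le_natDegree.trans_lt
        (by simpa [natDegree_realShiftedLegendre] using hjk))

lemma shiftedLegendre_one (k : ℕ) : shiftedLegendre k 1 = 1 := by
  rw [shiftedLegendre_eq_aeval, Polynomial.shiftedLegendre_eval_symm, ← mul_assoc, ← mul_pow]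
  simp [Polynomial.aeval_def, Polynomial.coeff_shiftedLegendre]

lemma Polynomial.degree_X_mul_derivative_sub_lt (p : ℝ[X]) :
    (X * derivative p - C (p.natDegree : ℝ) * p).degree < (p.natDegree : WithBot ℕ) := by
  rw [degree_lt_iff_coeff_zero]
  intro m hm
  rcases hm.eq_or_lt with rfl | hm
  · cases h : p.natDegree with
    | zero => simp
    | succ n => rw [coeff_sub, coeff_X_mul, coeff_derivative, coeff_C_mul]; push_cast; ring
  · obtain ⟨n, rfl⟩ : ∃ n, m = n + 1 := ⟨m - 1, by omega⟩
    simp [coeff_X_mul, coeff_derivative, coeff_eq_zero_of_natDegree_lt hm]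

lemma continuous_shiftedLegendre (k : ℕ) : Continuous (shiftedLegendre k) := by
  simpa only [eval_realShiftedLegendre] using (realShiftedLegendre k).continuous

lemma integral_shiftedLegendre_sq (k : ℕ) :
    (2 * (k : ℝ) + 1) * ∫ x in (0 : ℝ)..1, shiftedLegendre k x * shiftedLegendre k x = 1 := by
  set p := realShiftedLegendre k
  have hev : ∀ x, p.eval x = shiftedLegendre k x := eval_realShiftedLegendre k
  have hdeg : p.natDegree = k := natDegree_realShiftedLegendre k
  have hlow := integral_eval_mul_shiftedLegendre_eq_zero (k := k)
    (Polynomial.X * Polynomial.derivative p - Polynomial.C (p.natDegree : ℝ) * p)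
    (by simpa [hdeg] using Polynomial.degree_X_mul_derivative_sub_lt p)
  have hparts := Polynomial.integral_eval_mul_eval_derivative (Polynomial.X * p) p 0 1
  have hc := continuous_shiftedLegendre k
  have hd := (Polynomial.derivative p).continuous
  simp only [Polynomial.eval_mul, Polynomial.eval_sub, Polynomial.eval_X, Polynomial.eval_C,
    Polynomial.derivative_mul, Polynomial.derivative_X, Polynomial.eval_add,
    hev, shiftedLegendre_one, hdeg, one_mul, zero_mul, mul_one, sub_zero] at hlow hparts
  have h1 : ∫ x in (0 : ℝ)..1, (x * (Polynomial.derivative p).eval x - k * shiftedLegendre k x) *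
      shiftedLegendre k x =
      (∫ x in (0 : ℝ)..1, x * shiftedLegendre k x * (Polynomial.derivative p).eval x) -
        k * ∫ x in (0 : ℝ)..1, shiftedLegendre k x * shiftedLegendre k x := by
    rw [← intervalIntegral.integral_const_mul, ← intervalIntegral.integral_sub
      (Continuous.intervalIntegrable (by fun_prop) _ _)
      (Continuous.intervalIntegrable (by fun_prop) _ _)]
    congr 1 with x
    ring
  have h2 : ∫ x in (0 : ℝ)..1, (shiftedLegendre k x + x * (Polynomial.derivative p).eval x) *
      shiftedLegendre k x =
      (∫ x in (0 : ℝ)..1, shiftedLegendre k x * shiftedLegendre k x) +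
        ∫ x in (0 : ℝ)..1, x * shiftedLegendre k x * (Polynomial.derivative p).eval x := by
    rw [← intervalIntegral.integral_add
      (Continuous.intervalIntegrable (by fun_prop) _ _)
      (Continuous.intervalIntegrable (by fun_prop) _ _)]
    congr 1 with x
    ring
  linarith

/-- Bessel's inequality for the shifted Legendre polynomials. -/
lemma sum_sq_integral_mul_shiftedLegendre_le {f : ℝ → ℝ} (hf : ContinuousOn f (Icc (0 : ℝ) 1))
    (s : Finset ℕ) :
    ∑ k ∈ s, (2 * (k : ℝ) + 1) * (∫ x in (0 : ℝ)..1, f x * shiftedLegendre k x) ^ 2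
      ≤ ∫ x in (0 : ℝ)..1, f x ^ 2 := by
  set c : ℕ → ℝ := fun k => ∫ x in (0 : ℝ)..1, f x * shiftedLegendre k x
  set g : ℝ → ℝ := fun x => ∑ k ∈ s, (2 * (k : ℝ) + 1) * c k * shiftedLegendre k x with hgdef
  have hL := continuous_shiftedLegendre
  have hg : Continuous g := by fun_prop
  have hf' : ContinuousOn f (uIcc (0 : ℝ) 1) := by rwa [uIcc_of_le zero_le_one]
  have integral_mul_g : ∀ u : ℝ → ℝ, ContinuousOn u (uIcc (0 : ℝ) 1) →
      ∫ x in (0 : ℝ)..1, u x * g x =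
        ∑ k ∈ s, (2 * (k : ℝ) + 1) * c k * ∫ x in (0 : ℝ)..1, u x * shiftedLegendre k x := by
    intro u hu
    simp only [← intervalIntegral.integral_const_mul]
    rw [← intervalIntegral.integral_finsetSum fun k _ =>
      ContinuousOn.intervalIntegrable (by fun_prop)]
    congr 1 with x
    rw [hgdef, Finset.mul_sum]
    exact Finset.sum_congr rfl fun k _ => by ring
  have hgL : ∀ k ∈ s, ∫ x in (0 : ℝ)..1, g x * shiftedLegendre k x = c k := by
    intro k hk
    simp only [mul_comm (g _)]
    rw [integral_mul_g _ (hL k).continuousOn, Finset.sum_eq_single_of_mem k hk]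
    · linear_combination c k * integral_shiftedLegendre_sq k
    · intro j _ hjk
      rw [integral_shiftedLegendre_mul_of_ne hjk.symm, mul_zero]
  have hfg := integral_mul_g f hf'
  have hgg := integral_mul_g g hg.continuousOn
  rw [Finset.sum_congr rfl fun k hk => by rw [hgL k hk]] at hgg
  have hnonneg : 0 ≤ ∫ x in (0 : ℝ)..1, (f x - g x) ^ 2 :=
    intervalIntegral.integral_nonneg zero_le_one fun x _ => sq_nonneg _
  have hexp : ∫ x in (0 : ℝ)..1, (f x - g x) ^ 2 =
      (∫ x in (0 : ℝ)..1, f x ^ 2) - 2 * (∫ x in (0 : ℝ)..1, f x * g x) +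
        ∫ x in (0 : ℝ)..1, g x * g x := by
    rw [← intervalIntegral.integral_const_mul, ← intervalIntegral.integral_sub
      (ContinuousOn.intervalIntegrable (by fun_prop))
      (ContinuousOn.intervalIntegrable (by fun_prop)), ← intervalIntegral.integral_add
      (ContinuousOn.intervalIntegrable (by fun_prop))
      (ContinuousOn.intervalIntegrable (by fun_prop))]
    congr 1 with x
    ring
  have hS : ∑ k ∈ s, (2 * (k : ℝ) + 1) * c k ^ 2 = ∑ k ∈ s, (2 * (k : ℝ) + 1) * c k * c k :=
    Finset.sum_congr rfl fun k _ => by ring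
  linarith

lemma Matrix.dotProduct_transpose_mul_self_mulVec {m n : Type*} [Fintype m] [Fintype n]
    (A : Matrix m n ℝ) (v : n → ℝ) : v ⬝ᵥ (Aᵀ * A) *ᵥ v = ∑ i, (A *ᵥ v) i ^ 2 := by
  rw [← mulVec_mulVec, dotProduct_mulVec, vecMul_transpose]
  simp [dotProduct, sq]

open scoped MatrixOrder in
lemma Matrix.PosSemidef.exists_eq_transpose_mul_self {n : Type*} [Fintype n] [DecidableEq n]
    {R : Matrix n n ℝ} (hR : R.PosSemidef) : ∃ A : Matrix n n ℝ, R = Aᵀ * A := by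
  obtain ⟨A, hA⟩ := CStarAlgebra.nonneg_iff_eq_star_mul_self.mp hR.nonneg
  exact ⟨A, by rwa [star_eq_conjTranspose, conjTranspose_eq_transpose_of_trivial] at hA⟩

/-- **Bessel-like integral inequality (Lemma 2).** For a continuous `χ : [0,1] → ℝ²`
and a symmetric positive definite `R ∈ ℝ^{2×2}`, with `𝔛_k = ∫₀¹ χ(x) ℒ_k(x) dx`,
`∫₀¹ χᵀ R χ ≥ Σ_{k=0}^N (2k+1) 𝔛_kᵀ R 𝔛_k`. -/
theorem bessel_legendre_inequality
    (χ : ℝ → Fin 2 → ℝ) (hχ : ContinuousOn χ (Icc (0:ℝ) 1))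
    (R : Matrix (Fin 2) (Fin 2) ℝ) (hR : R.PosDef) (N : ℕ) :
    ∑ k ∈ Finset.range (N+1),
        (2 * (k : ℝ) + 1) *
          ((fun i => ∫ x in (0:ℝ)..1, χ x i * shiftedLegendre k x) ⬝ᵥ
            R.mulVec (fun i => ∫ x in (0:ℝ)..1, χ x i * shiftedLegendre k x))
      ≤ ∫ x in (0:ℝ)..1, χ x ⬝ᵥ R.mulVec (χ x) := by
  obtain ⟨A, hA⟩ := hR.posSemidef.exists_eq_transpose_mul_self
  have hχ' : ∀ j, ContinuousOn (fun x => χ x j) (Icc (0 : ℝ) 1) := continuousOn_pi.mp hχ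
  have hcont : ∀ i, ContinuousOn (fun x => (A *ᵥ χ x) i) (Icc (0 : ℝ) 1) := fun i => by
    simp only [Matrix.mulVec, dotProduct]
    fun_prop
  have hL := continuous_shiftedLegendre
  have hcoeff : ∀ k i, (A *ᵥ fun i => ∫ x in (0 : ℝ)..1, χ x i * shiftedLegendre k x) i =
      ∫ x in (0 : ℝ)..1, (A *ᵥ χ x) i * shiftedLegendre k x := fun k i => by
    simp only [Matrix.mulVec, dotProduct, Finset.sum_mul, mul_assoc]
    rw [intervalIntegral.integral_finsetSum fun j _ => ContinuousOn.intervalIntegrable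
      (by rw [uIcc_of_le zero_le_one]; fun_prop)]
    simp only [intervalIntegral.integral_const_mul]
  simp only [hA, Matrix.dotProduct_transpose_mul_self_mulVec, hcoeff, Finset.mul_sum]
  rw [Finset.sum_comm, intervalIntegral.integral_finsetSum fun i _ =>
    ContinuousOn.intervalIntegrable (by rw [uIcc_of_le zero_le_one]; exact (hcont i).pow 2)]
  exact Finset.sum_le_sum fun i _ => sum_sq_integral_mul_shiftedLegendre_le (hcont i) _
end

section
/- Let c > 0, let S, R ∈ ℝ^{2×2} be symmetric, and let χ : [0,1] × ℝ → ℝ² be continuously differentiable and satisfy ∂_t χ(x,t) = c ∂_x χ(x,t) for all x ∈ [0,1], t ∈ ℝ. Then the function 𝒱(t) = ∫₀¹ χ(x,t)ᵀ (S + x R) χ(x,t) dx is differentiable and d/dt 𝒱(t) = c ( χ(1,t)ᵀ (S+R) χ(1,t) − χ(0,t)ᵀ S χ(0,t) − ∫₀¹ χ(x,t)ᵀ R χ(x,t) dx ). -/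
open Set Matrix

section DotProduct

variable {m n : Type*} [Fintype n]

theorem HasDerivWithinAt.dotProduct {u v : ℝ → n → ℝ} {u' v' : n → ℝ} {s : Set ℝ} {x : ℝ}
    (hu : HasDerivWithinAt u u' s x) (hv : HasDerivWithinAt v v' s x) :
    HasDerivWithinAt (fun y => u y ⬝ᵥ v y) (u' ⬝ᵥ v x + u x ⬝ᵥ v') s x := by
  rw [hasDerivWithinAt_pi] at hu hv
  simp only [_root_.dotProduct, ← Finset.sum_add_distrib]
  exact HasDerivWithinAt.fun_sum fun i _ => (hu i).mul (hv i)

theorem HasDerivWithinAt.matrix_mulVec {A : ℝ → Matrix m n ℝ} {A' : Matrix m n ℝ}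
    {v : ℝ → n → ℝ} {v' : n → ℝ} {s : Set ℝ} {x : ℝ}
    (hA : ∀ i, HasDerivWithinAt (fun y => A y i) (A' i) s x) (hv : HasDerivWithinAt v v' s x) :
    HasDerivWithinAt (fun y => A y *ᵥ v y) (A' *ᵥ v x + A x *ᵥ v') s x :=
  hasDerivWithinAt_pi.2 fun i => (hA i).dotProduct hv

theorem ContinuousOn.dotProduct {X : Type*} [TopologicalSpace X] {u v : X → n → ℝ} {s : Set X}
    (hu : ContinuousOn u s) (hv : ContinuousOn v s) :
    ContinuousOn (fun x => u x ⬝ᵥ v x) s :=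
  continuousOn_iff_continuous_domRestrict.2 <|
    (continuousOn_iff_continuous_domRestrict.1 hu).dotProduct
      (continuousOn_iff_continuous_domRestrict.1 hv)

theorem ContinuousOn.matrix_mulVec {X : Type*} [TopologicalSpace X] {A : X → Matrix m n ℝ}
    {v : X → n → ℝ} {s : Set X} (hA : ContinuousOn A s) (hv : ContinuousOn v s) :
    ContinuousOn (fun x => A x *ᵥ v x) s :=
  continuousOn_iff_continuous_domRestrict.2 <|
    (continuousOn_iff_continuous_domRestrict.1 hA).matrix_mulVec
      (continuousOn_iff_continuous_domRestrict.1 hv)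

end DotProduct

/-- Differentiation under the integral sign over a compact interval, for an integrand whose
derivative in the parameter is jointly continuous. -/
theorem hasDerivAt_intervalIntegral_of_continuousOn {a b : ℝ} (hab : a ≤ b) {F F' : ℝ → ℝ → ℝ}
    (hF : ∀ t, ContinuousOn (fun x => F x t) (Icc a b))
    (hF' : ContinuousOn (fun p : ℝ × ℝ => F' p.1 p.2) (Icc a b ×ˢ univ))
    (hderiv : ∀ x ∈ Icc a b, ∀ t, HasDerivAt (fun s => F x s) (F' x t) t) (t : ℝ) :
    HasDerivAt (fun s => ∫ x in a..b, F x s) (∫ x in a..b, F' x t) t := by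
  have hsub : uIoc a b ⊆ Icc a b := uIoc_of_le hab ▸ Ioc_subset_Icc_self
  have hmeas : ∀ f : ℝ → ℝ, ContinuousOn f (Icc a b) →
      MeasureTheory.AEStronglyMeasurable f (MeasureTheory.volume.restrict (uIoc a b)) :=
    fun f hf => (hf.mono hsub).aestronglyMeasurable measurableSet_uIoc
  have hF't : ContinuousOn (fun x => F' x t) (Icc a b) :=
    hF'.comp (f := fun x : ℝ => (x, t)) (by fun_prop) fun x hx => ⟨hx, mem_univ t⟩
  obtain ⟨C, hC⟩ := (isCompact_Icc.prod (isCompact_closedBall t 1)).exists_bound_of_continuousOn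
    (hF'.mono (prod_mono_right (subset_univ _)))
  exact (intervalIntegral.hasDerivAt_integral_of_dominated_loc_of_deriv_le
    (F := fun s x => F x s) (F' := fun s x => F' x s) (bound := fun _ => C)
    (Metric.closedBall_mem_nhds t one_pos)
    (.of_forall fun s => hmeas _ (hF s)) ((hF t).intervalIntegrable_of_Icc hab) (hmeas _ hF't)
    (.of_forall fun x hx s hs => hC (x, s) ⟨hsub hx, hs⟩)
    intervalIntegrable_const
    (.of_forall fun x hx s _ => hderiv x (hsub hx) s)).2

/-- Time derivative of the functional `𝒱(t) = ∫₀¹ χᵀ(S+xR)χ dx` along solutions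
of the transport equation `∂_t χ = c ∂_x χ`:
`d𝒱/dt = c(χ(1)ᵀ(S+R)χ(1) − χ(0)ᵀSχ(0) − ∫₀¹ χᵀRχ)`. -/
theorem lyapunov_transport_derivative
    (c : ℝ) (hc : 0 < c)
    (S R : Matrix (Fin 2) (Fin 2) ℝ) (hS : S.IsSymm) (hR : R.IsSymm)
    (χ χx χt : ℝ → ℝ → Fin 2 → ℝ)
    (hχx : ∀ t : ℝ, ∀ x ∈ Icc (0:ℝ) 1,
      HasDerivWithinAt (fun y => χ y t) (χx x t) (Icc (0:ℝ) 1) x)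
    (hχt : ∀ x ∈ Icc (0:ℝ) 1, ∀ t : ℝ, HasDerivAt (fun s => χ x s) (χt x t) t)
    (hcχ : ContinuousOn (fun p : ℝ × ℝ => χ p.1 p.2) (Icc (0:ℝ) 1 ×ˢ univ))
    (hcχx : ContinuousOn (fun p : ℝ × ℝ => χx p.1 p.2) (Icc (0:ℝ) 1 ×ˢ univ))
    (hcχt : ContinuousOn (fun p : ℝ × ℝ => χt p.1 p.2) (Icc (0:ℝ) 1 ×ˢ univ))
    (htransport : ∀ x ∈ Icc (0:ℝ) 1, ∀ t : ℝ, χt x t = c • χx x t) :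
    ∀ t : ℝ,
      HasDerivAt
        (fun s => ∫ x in (0:ℝ)..1, χ x s ⬝ᵥ (S + x • R).mulVec (χ x s))
        (c * ((χ 1 t ⬝ᵥ (S + R).mulVec (χ 1 t)) - (χ 0 t ⬝ᵥ S.mulVec (χ 0 t))
          - ∫ x in (0:ℝ)..1, χ x t ⬝ᵥ R.mulVec (χ x t))) t := by
  intro t
  have slice {E : Type} [TopologicalSpace E] {f : ℝ → ℝ → E} (s : ℝ)
      (hf : ContinuousOn (fun p : ℝ × ℝ => f p.1 p.2) (Icc (0:ℝ) 1 ×ˢ univ)) :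
      ContinuousOn (fun x => f x s) (Icc (0:ℝ) 1) :=
    hf.comp (f := fun x : ℝ => (x, s)) (by fun_prop) fun x hx => ⟨hx, mem_univ s⟩
  have hA : Continuous fun p : ℝ × ℝ => S + p.1 • R := by fun_prop
  let D : ℝ → ℝ → ℝ := fun x s =>
    χt x s ⬝ᵥ (S + x • R) *ᵥ χ x s + χ x s ⬝ᵥ (S + x • R) *ᵥ χt x s
  have hD : ContinuousOn (fun p : ℝ × ℝ => D p.1 p.2) (Icc (0:ℝ) 1 ×ˢ univ) :=
    (hcχt.dotProduct (hA.continuousOn.matrix_mulVec hcχ)).add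
      (hcχ.dotProduct (hA.continuousOn.matrix_mulVec hcχt))
  have hV : ContinuousOn (fun p : ℝ × ℝ => χ p.1 p.2 ⬝ᵥ (S + p.1 • R) *ᵥ χ p.1 p.2)
      (Icc (0:ℝ) 1 ×ˢ univ) :=
    hcχ.dotProduct (hA.continuousOn.matrix_mulVec hcχ)
  have hderiv := hasDerivAt_intervalIntegral_of_continuousOn zero_le_one
    (F := fun x s => χ x s ⬝ᵥ (S + x • R) *ᵥ χ x s) (F' := D)
    (fun s => slice (f := fun x s => χ x s ⬝ᵥ (S + x • R) *ᵥ χ x s) s hV) hD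
    (fun x hx s => by
      have h := (hχt x hx s).hasDerivWithinAt (s := univ)
      have h' := h.dotProduct (HasDerivWithinAt.matrix_mulVec (A := fun _ => S + x • R) (A' := 0)
        (fun i => hasDerivWithinAt_const s univ _) h)
      simpa [D] using h') t
  have hQ : ContinuousOn (fun x => χ x t ⬝ᵥ R *ᵥ χ x t) (Icc (0:ℝ) 1) :=
    (slice t hcχ).dotProduct (continuousOn_const.matrix_mulVec (slice t hcχ))
  have hDt : ContinuousOn (fun x => D x t) (Icc (0:ℝ) 1) := slice t hD
  have hQint := hQ.intervalIntegrable_of_Icc (μ := MeasureTheory.volume) zero_le_one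
  have hDint := hDt.intervalIntegrable_of_Icc (μ := MeasureTheory.volume) zero_le_one
  have hFTC : ∫ x in (0:ℝ)..1, (D x t + c * (χ x t ⬝ᵥ R *ᵥ χ x t)) =
      c * (χ 1 t ⬝ᵥ (S + (1:ℝ) • R) *ᵥ χ 1 t) - c * (χ 0 t ⬝ᵥ (S + (0:ℝ) • R) *ᵥ χ 0 t) := by
    refine intervalIntegral.integral_eq_sub_of_hasDerivAt_of_le zero_le_one
      (f := fun x => c * (χ x t ⬝ᵥ (S + x • R) *ᵥ χ x t))
      (continuousOn_const.mul (slice (f := fun x s => χ x s ⬝ᵥ (S + x • R) *ᵥ χ x s) t hV))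
      (fun x hx => ?_) (hDint.add (hQint.const_mul c))
    have hx' := Ioo_subset_Icc_self hx
    have hAx : ∀ i, HasDerivWithinAt (fun y : ℝ => (S + y • R) i) (R i) (Icc (0:ℝ) 1) x :=
      fun i => by
        have h := ((hasDerivWithinAt_id x (Icc (0:ℝ) 1)).smul_const (R i)).const_add (S i)
        rwa [one_smul] at h
    have h := ((hχx t x hx').dotProduct
      (HasDerivWithinAt.matrix_mulVec hAx (hχx t x hx'))).const_mul c
    convert h.hasDerivAt (Icc_mem_nhds hx.1 hx.2) using 1
    simp only [D, htransport x hx' t, smul_dotProduct, mulVec_smul, dotProduct_smul,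
      dotProduct_add, smul_eq_mul]
    ring
  rw [intervalIntegral.integral_add hDint (hQint.const_mul c),
    intervalIntegral.integral_const_mul, one_smul, zero_smul, add_zero] at hFTC
  convert hderiv using 1
  linarith
end

section
/- Let n ≥ 1, c > 0, c₀ ≥ 0, A ∈ ℝ^{n×n}, B ∈ ℝ^{n×1}, K ∈ ℝ^{1×n}, and suppose A + BK is invertible. Define f(y) = (1 − (c c₀ − 1) sinh(y) / (2 (cosh(y) + c c₀ sinh(y)))) e^{−y} for y > 0. Then there exists λ_max > 0 such that for every λ ∈ (0, λ_max), the matrix λ I_n − (A + B K f(λ/c)) is invertible. -/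
open Matrix Real

/-- If `A + BK` is invertible, then for all small enough `λ > 0` the matrix
`λ Iₙ − (A + BK f(λ/c))` is invertible, where
`f(y) = (1 − (cc₀−1) sinh y / (2(cosh y + cc₀ sinh y))) e^{−y}`. -/
theorem resolvent_invertible_small_lambda
    (n : ℕ) (hn : 1 ≤ n) (c c₀ : ℝ) (hc : 0 < c) (hc₀ : 0 ≤ c₀)
    (A : Matrix (Fin n) (Fin n) ℝ) (B : Matrix (Fin n) (Fin 1) ℝ)
    (K : Matrix (Fin 1) (Fin n) ℝ)
    (hABK : IsUnit (A + B * K))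
    (f : ℝ → ℝ)
    (hf : ∀ y, f y =
      (1 - (c * c₀ - 1) * Real.sinh y / (2 * (Real.cosh y + c * c₀ * Real.sinh y)))
        * Real.exp (-y)) :
    ∃ lamMax > (0:ℝ), ∀ lam ∈ Set.Ioo (0:ℝ) lamMax,
      IsUnit (lam • (1 : Matrix (Fin n) (Fin n) ℝ) - (A + f (lam / c) • (B * K))) := by
  have hf0 : f 0 = 1 := by simp [hf]
  have hfc : ContinuousAt f 0 := by
    rw [funext hf]
    have hden : 2 * (Real.cosh 0 + c * c₀ * Real.sinh 0) ≠ 0 := by simp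
    refine ContinuousAt.mul (continuousAt_const.sub (ContinuousAt.div ?_ ?_ hden)) ?_ <;> fun_prop
  have hfc' : ContinuousAt (fun lam : ℝ => f (lam / c)) 0 := by
    refine ContinuousAt.comp (g := f) ?_ (by fun_prop)
    simpa using hfc
  have hM : ContinuousAt (fun lam : ℝ =>
      (lam • (1 : Matrix (Fin n) (Fin n) ℝ) - (A + f (lam / c) • (B * K))).det) 0 := by
    refine ContinuousAt.comp (g := Matrix.det) (continuous_id.matrix_det).continuousAt ?_
    exact (continuousAt_id.smul continuousAt_const).sub
      (continuousAt_const.add (hfc'.smul continuousAt_const))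
  have h0 : ((0 : ℝ) • (1 : Matrix (Fin n) (Fin n) ℝ) - (A + f (0 / c) • (B * K))).det ≠ 0 := by
    have h := (Matrix.isUnit_iff_isUnit_det _).mp hABK.neg
    simpa [hf0] using h.ne_zero
  obtain ⟨ε, hε, h⟩ := Metric.eventually_nhds_iff.mp (hM.eventually_ne h0)
  refine ⟨ε, hε, fun lam hlam => (Matrix.isUnit_iff_isUnit_det _).mpr (isUnit_iff_ne_zero.mpr (h ?_))⟩
  simpa [Real.dist_eq, abs_of_pos hlam.1] using hlam.2
end

section
/- Let n ≥ 1, c > 0, K ∈ ℝ^{1×n}, let P₀ ∈ ℝ^{(n+2)×(n+2)} and S, R ∈ ℝ^{2×2} be symmetric positive definite. For X ∈ ℝⁿ, u ∈ C¹([0,1], ℝ), v ∈ C⁰([0,1], ℝ), define χ(x) = [v(x) + c u'(x); v(1−x) − c u'(1−x)] ∈ ℝ², 𝔛₀ = ∫₀¹ χ(x) dx, and V₀(X, u, v) = [X; 𝔛₀]ᵀ P₀ [X; 𝔛₀] + ∫₀¹ χ(x)ᵀ (S + x R) χ(x) dx. Then there exist ε₁, ε₂ > 0, depending only on (P₀,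 S, R, K, c, n), such that for all such (X, u, v) with u(0) = K X, one has ε₁ ‖(X,u,v)‖²_H ≤ V₀(X, u, v) ≤ ε₂ ‖(X,u,v)‖²_H. -/
open Set Matrix

/-- A positive definite quadratic form is bounded below and above by positive multiples of the sum
of squares of the coordinates. -/
theorem Matrix.PosDef.exists_bounds {ι : Type*} [Fintype ι] {M : Matrix ι ι ℝ} (hM : M.PosDef) :
    ∃ a > (0:ℝ), ∃ b > (0:ℝ), ∀ x : ι → ℝ,
      a * ∑ i, x i ^ 2 ≤ x ⬝ᵥ M.mulVec x ∧ x ⬝ᵥ M.mulVec x ≤ b * ∑ i, x i ^ 2 := by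
  have hcont : Continuous fun x : ι → ℝ => x ⬝ᵥ M.mulVec x := by
    unfold dotProduct mulVec dotProduct
    fun_prop
  have hcomp : IsCompact {x : ι → ℝ | ∑ i, x i ^ 2 = 1} := by
    refine (isCompact_univ_pi fun _ : ι => isCompact_Icc (a := (-1:ℝ)) (b := 1)).of_isClosed_subset
      (isClosed_eq (by fun_prop) continuous_const) ?_
    intro x hx i _
    have h : x i ^ 2 ≤ ∑ j, x j ^ 2 :=
      Finset.single_le_sum (f := fun j => x j ^ 2) (fun j _ => sq_nonneg _) (Finset.mem_univ i)
    replace h : x i ^ 2 ≤ 1 := h.trans_eq hx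
    exact abs_le.mp ((sq_le_one_iff_abs_le_one _).mp h)
  have hpos : ∀ x : ι → ℝ, x ≠ 0 → 0 < x ⬝ᵥ M.mulVec x := fun x hx => by
    simpa using hM.dotProduct_mulVec_pos hx
  have hsphere : ∃ a > (0:ℝ), ∃ b > (0:ℝ), ∀ x : ι → ℝ, ∑ i, x i ^ 2 = 1 →
      a ≤ x ⬝ᵥ M.mulVec x ∧ x ⬝ᵥ M.mulVec x ≤ b := by
    rcases {x : ι → ℝ | ∑ i, x i ^ 2 = 1}.eq_empty_or_nonempty with he | hne
    · exact ⟨1, one_pos, 1, one_pos, fun x hx => (he.subset hx).elim⟩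
    · obtain ⟨y, hy, hmin⟩ := hcomp.exists_isMinOn hne hcont.continuousOn
      obtain ⟨z, hz, hmax⟩ := hcomp.exists_isMaxOn hne hcont.continuousOn
      have hne0 : ∀ x : ι → ℝ, ∑ i, x i ^ 2 = 1 → x ≠ 0 := by
        rintro x hx rfl
        simp at hx
      exact ⟨_, hpos y (hne0 y hy), _, hpos z (hne0 z hz), fun x hx => ⟨hmin hx, hmax hx⟩⟩
  obtain ⟨a, ha, b, hb, h⟩ := hsphere
  refine ⟨a, ha, b, hb, fun x => ?_⟩
  rcases eq_or_ne x 0 with rfl | hx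
  · simp
  have hs : 0 < ∑ i, x i ^ 2 := by
    obtain ⟨i, hi⟩ := Function.ne_iff.mp hx
    exact Finset.sum_pos' (fun j _ => sq_nonneg _) ⟨i, Finset.mem_univ i, by
      have : x i ≠ 0 := hi
      positivity⟩
  set s := ∑ i, x i ^ 2 with hsdef
  have hr : (Real.sqrt s)⁻¹ ^ 2 = s⁻¹ := by rw [inv_pow, Real.sq_sqrt hs.le]
  have h1 := h ((Real.sqrt s)⁻¹ • x) (by
    simp only [Pi.smul_apply, smul_eq_mul, mul_pow, ← Finset.mul_sum, ← hsdef, hr]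
    exact inv_mul_cancel₀ hs.ne')
  rw [mulVec_smul, dotProduct_smul, smul_dotProduct, smul_eq_mul, smul_eq_mul, ← mul_assoc,
    ← sq, hr, inv_mul_eq_div, le_div_iff₀ hs, div_le_iff₀ hs] at h1
  exact h1

/-- Cauchy-Schwarz against the constant function `1` on a subinterval `[0, x]` of `[0, 1]`. -/
theorem sq_integral_le_integral_sq {f : ℝ → ℝ} (hf : ContinuousOn f (Icc 0 1)) {x : ℝ}
    (hx : x ∈ Icc (0:ℝ) 1) :
    (∫ t in (0:ℝ)..x, f t) ^ 2 ≤ ∫ t in (0:ℝ)..1, f t ^ 2 := by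
  have hfx : ContinuousOn f (Icc 0 x) := hf.mono (Icc_subset_Icc_right hx.2)
  have hi : IntervalIntegrable f MeasureTheory.volume 0 x :=
    hfx.intervalIntegrable_of_Icc hx.1
  have hi2 : IntervalIntegrable (fun t => f t ^ 2) MeasureTheory.volume 0 x :=
    (hfx.pow 2).intervalIntegrable_of_Icc hx.1
  set m := ∫ t in (0:ℝ)..x, f t with hm
  have h0 : 0 ≤ ∫ t in (0:ℝ)..x, (f t - m) ^ 2 :=
    intervalIntegral.integral_nonneg hx.1 fun t _ => sq_nonneg _
  have he : ∫ t in (0:ℝ)..x, (f t - m) ^ 2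
      = (∫ t in (0:ℝ)..x, f t ^ 2) - 2 * m * m + x * m ^ 2 := by
    have : ∀ t, (f t - m) ^ 2 = f t ^ 2 - 2 * m * f t + m ^ 2 := fun t => by ring
    simp only [this]
    rw [intervalIntegral.integral_add (hi2.sub (hi.const_mul _)) (by simp),
      intervalIntegral.integral_sub hi2 (hi.const_mul _), intervalIntegral.integral_const_mul]
    simp [hm]
  have hmono : ∫ t in (0:ℝ)..x, f t ^ 2 ≤ ∫ t in (0:ℝ)..1, f t ^ 2 :=
    intervalIntegral.integral_mono_interval le_rfl hx.1 hx.2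
      (Filter.Eventually.of_forall fun t => sq_nonneg _)
      ((hf.pow 2).intervalIntegrable_of_Icc zero_le_one)
  nlinarith [mul_nonneg (sub_nonneg.mpr hx.2) (sq_nonneg m)]

/-- A Poincaré-type inequality on `[0, 1]`. -/
theorem integral_sq_le_of_hasDerivWithinAt {u du : ℝ → ℝ}
    (hu : ∀ x ∈ Icc (0:ℝ) 1, HasDerivWithinAt u (du x) (Icc (0:ℝ) 1) x)
    (hdu : ContinuousOn du (Icc (0:ℝ) 1)) :
    ∫ x in (0:ℝ)..1, u x ^ 2 ≤ 2 * u 0 ^ 2 + 2 * ∫ x in (0:ℝ)..1, du x ^ 2 := by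
  have hcu : ContinuousOn u (Icc 0 1) := fun x hx => (hu x hx).continuousWithinAt
  have hpt : ∀ x ∈ Icc (0:ℝ) 1, u x ^ 2 ≤ 2 * u 0 ^ 2 + 2 * ∫ x in (0:ℝ)..1, du x ^ 2 := by
    intro x hx
    have hsub : Icc (0:ℝ) x ⊆ Icc 0 1 := Icc_subset_Icc_right hx.2
    have hftc : ∫ t in (0:ℝ)..x, du t = u x - u 0 :=
      intervalIntegral.integral_eq_sub_of_hasDerivAt_of_le hx.1 (hcu.mono hsub)
        (fun t ht => (hu t (hsub (Ioo_subset_Icc_self ht))).hasDerivAt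
          (Icc_mem_nhds ht.1 (ht.2.trans_le hx.2)))
        ((hdu.mono hsub).intervalIntegrable_of_Icc hx.1)
    have hcs := sq_integral_le_integral_sq hdu hx
    rw [hftc] at hcs
    nlinarith [sq_nonneg (u x - 2 * u 0)]
  calc ∫ x in (0:ℝ)..1, u x ^ 2
      ≤ ∫ _ in (0:ℝ)..1, (2 * u 0 ^ 2 + 2 * ∫ x in (0:ℝ)..1, du x ^ 2) :=
        intervalIntegral.integral_mono_on zero_le_one
          ((hcu.pow 2).intervalIntegrable_of_Icc zero_le_one) (by simp) hpt
    _ = _ := by simp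

/-- Parallelogram identity for the Riemann coordinates, the second of which is reflected. -/
theorem integral_sq_riemann_coordinates {f v : ℝ → ℝ} (c : ℝ)
    (hf : ContinuousOn f (Icc (0:ℝ) 1)) (hv : ContinuousOn v (Icc (0:ℝ) 1)) :
    (∫ x in (0:ℝ)..1, (v x + c * f x) ^ 2) + (∫ x in (0:ℝ)..1, (v (1 - x) - c * f (1 - x)) ^ 2)
      = 2 * (c ^ 2 * (∫ x in (0:ℝ)..1, f x ^ 2) + ∫ x in (0:ℝ)..1, v x ^ 2) := by
  have hrefl := intervalIntegral.integral_comp_sub_left (a := (0:ℝ)) (b := 1)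
    (fun x => (v x - c * f x) ^ 2) 1
  simp only [sub_self, sub_zero] at hrefl
  have hint : ∀ {g : ℝ → ℝ}, ContinuousOn g (Icc 0 1) →
      IntervalIntegrable g MeasureTheory.volume 0 1 :=
    fun hg => hg.intervalIntegrable_of_Icc zero_le_one
  rw [hrefl, ← intervalIntegral.integral_add (hint (by fun_prop)) (hint (by fun_prop)),
    ← intervalIntegral.integral_const_mul,
    ← intervalIntegral.integral_add (hint (by fun_prop)) (hint (by fun_prop)),
    ← intervalIntegral.integral_const_mul]
  congr 1
  ext x
  ring

/-- Equivalence of the Lyapunov functional `V₀` with the `H`-norm: there exist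
`ε₁, ε₂ > 0` such that `ε₁‖(X,u,v)‖²_H ≤ V₀(X,u,v) ≤ ε₂‖(X,u,v)‖²_H` for all
`(X,u,v)` with `u ∈ C¹`, `v ∈ C⁰` and `u(0) = KX`. -/
theorem lyapunov_V0_norm_equivalence
    (n : ℕ) (hn : 1 ≤ n) (c : ℝ) (hc : 0 < c)
    (K : Matrix (Fin 1) (Fin n) ℝ)
    (P₀ : Matrix (Fin n ⊕ Fin 2) (Fin n ⊕ Fin 2) ℝ)
    (S R : Matrix (Fin 2) (Fin 2) ℝ)
    (hP : P₀.PosDef) (hS : S.PosDef) (hR : R.PosDef) :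
    ∃ ε₁ > (0:ℝ), ∃ ε₂ > (0:ℝ),
      ∀ (X : Fin n → ℝ) (u du v : ℝ → ℝ),
        (∀ x ∈ Icc (0:ℝ) 1, HasDerivWithinAt u (du x) (Icc (0:ℝ) 1) x) →
        ContinuousOn du (Icc (0:ℝ) 1) →
        ContinuousOn v (Icc (0:ℝ) 1) →
        u 0 = ∑ i, K 0 i * X i →
        (ε₁ * ((∑ i, (X i)^2) + (∫ x in (0:ℝ)..1, (u x)^2)
              + c^2 * (∫ x in (0:ℝ)..1, (du x)^2) + ∫ x in (0:ℝ)..1, (v x)^2)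
          ≤ (Sum.elim X
                (fun i => ∫ x in (0:ℝ)..1,
                  (![v x + c * du x, v (1-x) - c * du (1-x)] : Fin 2 → ℝ) i) ⬝ᵥ
              P₀.mulVec
                (Sum.elim X
                  (fun i => ∫ x in (0:ℝ)..1,
                    (![v x + c * du x, v (1-x) - c * du (1-x)] : Fin 2 → ℝ) i))
            + ∫ x in (0:ℝ)..1,
                (![v x + c * du x, v (1-x) - c * du (1-x)] : Fin 2 → ℝ) ⬝ᵥ
                  (S + x • R).mulVec
                    (![v x + c * du x, v (1-x) - c * du (1-x)] : Fin 2 → ℝ)))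
        ∧
        ((Sum.elim X
              (fun i => ∫ x in (0:ℝ)..1,
                (![v x + c * du x, v (1-x) - c * du (1-x)] : Fin 2 → ℝ) i) ⬝ᵥ
            P₀.mulVec
              (Sum.elim X
                (fun i => ∫ x in (0:ℝ)..1,
                  (![v x + c * du x, v (1-x) - c * du (1-x)] : Fin 2 → ℝ) i))
          + ∫ x in (0:ℝ)..1,
              (![v x + c * du x, v (1-x) - c * du (1-x)] : Fin 2 → ℝ) ⬝ᵥ
                (S + x • R).mulVec
                  (![v x + c * du x, v (1-x) - c * du (1-x)] : Fin 2 → ℝ))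
          ≤ ε₂ * ((∑ i, (X i)^2) + (∫ x in (0:ℝ)..1, (u x)^2)
              + c^2 * (∫ x in (0:ℝ)..1, (du x)^2) + ∫ x in (0:ℝ)..1, (v x)^2)) := by
  obtain ⟨p₁, hp₁, p₂, hp₂, hPb⟩ := hP.exists_bounds
  obtain ⟨s₁, hs₁, s₂, hs₂, hSb⟩ := hS.exists_bounds
  obtain ⟨r₁, hr₁, r₂, hr₂, hRb⟩ := hR.exists_bounds
  set k := ∑ i, K 0 i ^ 2 with hk
  have hk0 : 0 ≤ k := Finset.sum_nonneg fun i _ => sq_nonneg _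
  have hL : 0 < 1 + 2 * k + 2 / c ^ 2 := by positivity
  refine ⟨min p₁ s₁ / (1 + 2 * k + 2 / c ^ 2), div_pos (lt_min hp₁ hs₁) hL,
    2 * (p₂ + s₂ + r₂), by positivity, ?_⟩
  intro X u du v hu hdu hv hu0
  have hrev : MapsTo (fun x : ℝ => 1 - x) (Icc 0 1) (Icc 0 1) :=
    fun x hx => ⟨by linarith [hx.2], by linarith [hx.1]⟩
  have hdu' : ContinuousOn (fun x => du (1 - x)) (Icc 0 1) := hdu.comp (by fun_prop) hrev
  have hv' : ContinuousOn (fun x => v (1 - x)) (Icc 0 1) := hv.comp (by fun_prop) hrev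
  have hw : ContinuousOn (fun x => v x + c * du x) (Icc 0 1) := by fun_prop
  have hz : ContinuousOn (fun x => v (1 - x) - c * du (1 - x)) (Icc 0 1) := by fun_prop
  have hpoin := integral_sq_le_of_hasDerivWithinAt hu hdu
  have hpar := integral_sq_riemann_coordinates c hdu hv
  have hcs : u 0 ^ 2 ≤ k * ∑ i, X i ^ 2 := by
    rw [hu0]
    exact Finset.sum_mul_sq_le_sq_mul_sq _ _ _
  have hwcs := sq_integral_le_integral_sq hw (right_mem_Icc.mpr zero_le_one)
  have hzcs := sq_integral_le_integral_sq hz (right_mem_Icc.mpr zero_le_one)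
  obtain ⟨hPl, hPu⟩ := hPb (Sum.elim X
    (fun i => ∫ x in (0:ℝ)..1, (![v x + c * du x, v (1-x) - c * du (1-x)] : Fin 2 → ℝ) i))
  set J := ∫ x in (0:ℝ)..1, (![v x + c * du x, v (1-x) - c * du (1-x)] : Fin 2 → ℝ) ⬝ᵥ
    (S + x • R).mulVec (![v x + c * du x, v (1-x) - c * du (1-x)] : Fin 2 → ℝ) with hJ
  simp only [Fintype.sum_sum_type, Sum.elim_inl, Sum.elim_inr, Fin.sum_univ_two,
    Matrix.cons_val_zero, Matrix.cons_val_one] at hPl hPu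
  have hint : ∀ {g : ℝ → ℝ}, ContinuousOn g (Icc 0 1) →
      IntervalIntegrable g MeasureTheory.volume 0 1 :=
    fun hg => hg.intervalIntegrable_of_Icc zero_le_one
  have hsum := intervalIntegral.integral_add (hint (hw.pow 2)) (hint (hz.pow 2))
  have hJint : IntervalIntegrable (fun x =>
      (![v x + c * du x, v (1-x) - c * du (1-x)] : Fin 2 → ℝ) ⬝ᵥ
        (S + x • R).mulVec (![v x + c * du x, v (1-x) - c * du (1-x)] : Fin 2 → ℝ))
      MeasureTheory.volume 0 1 := by
    apply hint
    simp only [dotProduct, mulVec, Fin.sum_univ_two, Matrix.cons_val_zero, Matrix.cons_val_one,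
      Matrix.add_apply, Matrix.smul_apply, smul_eq_mul]
    fun_prop
  have hform : ∀ x ∈ Icc (0:ℝ) 1, ∀ y : Fin 2 → ℝ,
      s₁ * (y 0 ^ 2 + y 1 ^ 2) ≤ y ⬝ᵥ (S + x • R).mulVec y ∧
      y ⬝ᵥ (S + x • R).mulVec y ≤ (s₂ + r₂) * (y 0 ^ 2 + y 1 ^ 2) := by
    intro x hx y
    obtain ⟨h1, h2⟩ := hSb y
    obtain ⟨h3, h4⟩ := hRb y
    rw [Fin.sum_univ_two] at h1 h2 h3 h4
    have h5 : 0 ≤ y ⬝ᵥ R.mulVec y := le_trans (by positivity) h3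
    rw [add_mulVec, smul_mulVec, dotProduct_add, dotProduct_smul, smul_eq_mul]
    have h6 := mul_nonneg hx.1 h5
    have h7 := mul_le_mul_of_nonneg_right hx.2 h5
    constructor <;> linarith
  have hJl := intervalIntegral.integral_mono_on zero_le_one
    ((hint ((hw.pow 2).add (hz.pow 2))).const_mul s₁) hJint
    (fun x hx => (hform x hx ![v x + c * du x, v (1-x) - c * du (1-x)]).1)
  have hJu := intervalIntegral.integral_mono_on zero_le_one hJint
    ((hint ((hw.pow 2).add (hz.pow 2))).const_mul (s₂ + r₂))
    (fun x hx => (hform x hx ![v x + c * du x, v (1-x) - c * du (1-x)]).2)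
  rw [intervalIntegral.integral_const_mul] at hJl hJu
  simp only [Pi.add_apply, Pi.pow_apply] at hJl hJu hsum
  rw [hsum, hpar, ← hJ] at hJl hJu
  have hA0 : 0 ≤ ∫ x in (0:ℝ)..1, u x ^ 2 :=
    intervalIntegral.integral_nonneg zero_le_one fun t _ => sq_nonneg _
  have hB0 : 0 ≤ ∫ x in (0:ℝ)..1, du x ^ 2 :=
    intervalIntegral.integral_nonneg zero_le_one fun t _ => sq_nonneg _
  have hD0 : 0 ≤ ∫ x in (0:ℝ)..1, v x ^ 2 :=
    intervalIntegral.integral_nonneg zero_le_one fun t _ => sq_nonneg _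
  have hE0 : 0 ≤ ∑ i, X i ^ 2 := Finset.sum_nonneg fun i _ => sq_nonneg _
  set E := ∑ i, X i ^ 2
  set A := ∫ x in (0:ℝ)..1, u x ^ 2
  set B := ∫ x in (0:ℝ)..1, du x ^ 2
  set D := ∫ x in (0:ℝ)..1, v x ^ 2
  have hcB : 0 ≤ c ^ 2 * B := by positivity
  have hT : (∫ x in (0:ℝ)..1, (v x + c * du x)) ^ 2
      + (∫ x in (0:ℝ)..1, (v (1 - x) - c * du (1 - x))) ^ 2 ≤ 2 * (c ^ 2 * B + D) := by
    linarith
  have hT0 : 0 ≤ (∫ x in (0:ℝ)..1, (v x + c * du x)) ^ 2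
      + (∫ x in (0:ℝ)..1, (v (1 - x) - c * du (1 - x))) ^ 2 := by positivity
  set T := (∫ x in (0:ℝ)..1, (v x + c * du x)) ^ 2
      + (∫ x in (0:ℝ)..1, (v (1 - x) - c * du (1 - x))) ^ 2
  constructor
  · have hN : E + A + c ^ 2 * B + D ≤ (1 + 2 * k + 2 / c ^ 2) * (E + (c ^ 2 * B + D)) := by
      have hB : 2 * B = 2 / c ^ 2 * (c ^ 2 * B) := by field_simp
      have h1 : 0 ≤ k * (c ^ 2 * B + D) := by positivity
      have h2 : 0 ≤ 2 / c ^ 2 * (E + D) := by positivity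
      linarith
    calc _ ≤ min p₁ s₁ / (1 + 2 * k + 2 / c ^ 2) *
          ((1 + 2 * k + 2 / c ^ 2) * (E + (c ^ 2 * B + D))) := by
          have := lt_min hp₁ hs₁
          gcongr
      _ = min p₁ s₁ * E + min p₁ s₁ * (c ^ 2 * B + D) := by field_simp
      _ ≤ p₁ * (E + T) + s₁ * (2 * (c ^ 2 * B + D)) := by
          have h1 : min p₁ s₁ * E ≤ p₁ * (E + T) := by
            gcongr
            · exact min_le_left _ _
            · linarith
          have h2 : min p₁ s₁ * (c ^ 2 * B + D) ≤ s₁ * (2 * (c ^ 2 * B + D)) := by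
            gcongr
            · exact min_le_right _ _
            · linarith
          exact add_le_add h1 h2
      _ ≤ _ := add_le_add hPl hJl
  · calc _ ≤ p₂ * (E + T) + (s₂ + r₂) * (2 * (c ^ 2 * B + D)) := add_le_add hPu hJu
      _ ≤ p₂ * (2 * (E + A + c ^ 2 * B + D)) + (s₂ + r₂) * (2 * (E + A + c ^ 2 * B + D)) := by
          gcongr <;> linarith
      _ = _ := by ring
end
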